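/- arXiv:2110.12184 — 7 statements merged into one kernel-verified Lean document; each statement's English description precedes it below -/
import Mathlib

section
/- Let P_S and P_T be joint distributions on 𝒵 × 𝒴 and let P_{S+T} = (1/2)(P_S + P_T) be their mixture. Let I_{S+T}(Z₁;Z₂) denote the mutual information of the conditionally-i.i.d. pair distribution of P_{S+T}, let H(Y) denote the entropy of the 𝒴-marginal of P_{S+T}, and let d_{HΔH}(P_S(Z), P_T(Z)) denote the HΔH-divergence between the 𝒵-marginals of P_S and P_T, taken over the hypothesis class of all functions 𝒵 → 𝒴. Then for every classifier F : 𝒵 → 𝒴: ε_{P_T}(F) ≤ ε_{P_S}(F) − 4·I_{S+T}(Z₁;Z₂) + (1/2)·d_{HΔH}(P_S(Z), P_T(Z)) + 4·H(Y). -/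
open Finset

/-- Marginal on `Z` of a joint pmf on `Z × Y`. -/
noncomputable def margZ {Z Y : Type*} [Fintype Y] (P : Z × Y → ℝ) (z : Z) : ℝ :=
  ∑ y, P (z, y)

/-- Marginal on `Y` of a joint pmf on `Z × Y`. -/
noncomputable def margY {Z Y : Type*} [Fintype Z] (P : Z × Y → ℝ) (y : Y) : ℝ :=
  ∑ z, P (z, y)

/-- Expected risk `ε_P(F) = ∑_{z : P(z)>0} P(z) ∑_y |1[y = F z] − P(y|z)|`. -/
noncomputable def risk {Z Y : Type*} [Fintype Z] [Fintype Y] [DecidableEq Y]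
    (P : Z × Y → ℝ) (F : Z → Y) : ℝ :=
  ∑ z ∈ Finset.univ.filter (fun z => 0 < margZ P z),
    margZ P z * ∑ y, |(if y = F z then (1 : ℝ) else 0) - P (z, y) / margZ P z|

/-- Disagreement of two classifiers w.r.t. a distribution on `Z`. -/
noncomputable def disag {Z : Type*} (Y : Type*) [Fintype Z] [Fintype Y] [DecidableEq Y]
    (Pz : Z → ℝ) (F₁ F₂ : Z → Y) : ℝ :=
  ∑ z, Pz z * ∑ y, |(if y = F₁ z then (1 : ℝ) else 0) - (if y = F₂ z then (1 : ℝ) else 0)|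

/-- `HΔH`-divergence over the hypothesis class of all functions `Z → Y`. -/
noncomputable def dHH {Z : Type*} (Y : Type*) [Fintype Z] [Fintype Y] [DecidableEq Y]
    (P₁ P₂ : Z → ℝ) : ℝ :=
  2 * ⨆ F₁ : Z → Y, ⨆ F₂ : Z → Y, |disag Y P₁ F₁ F₂ - disag Y P₂ F₁ F₂|

/-- Mutual information of a joint pmf on `A × B` (natural log). -/
noncomputable def MI {A B : Type*} [Fintype A] [Fintype B] (P : A × B → ℝ) : ℝ :=
  ∑ p ∈ Finset.univ.filter (fun p => 0 < P p),
    P p * Real.log (P p / ((∑ b, P (p.1, b)) * (∑ a, P (a, p.2))))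

/-- Entropy of the `Y`-marginal (natural log, `0 log 0 = 0`). -/
noncomputable def entY {Z Y : Type*} [Fintype Z] [Fintype Y] (P : Z × Y → ℝ) : ℝ :=
  -∑ y, margY P y * Real.log (margY P y)

/-- Conditionally-i.i.d. pair distribution `P⊗(z₁,z₂) = ∑_{y : P(y)>0} P(y) P(z₁|y) P(z₂|y)`. -/
noncomputable def pairDist {Z Y : Type*} [Fintype Z] [Fintype Y] (P : Z × Y → ℝ) :
    Z × Z → ℝ := fun p =>
  ∑ y ∈ Finset.univ.filter (fun y => 0 < margY P y),
    margY P y * (P (p.1, y) / margY P y) * (P (p.2, y) / margY P y)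

/-- Kullback–Leibler divergence of finite pmfs (natural log). -/
noncomputable def KL {X : Type*} [Fintype X] (p q : X → ℝ) : ℝ :=
  ∑ x ∈ Finset.univ.filter (fun x => 0 < p x), p x * Real.log (p x / q x)

lemma risk_eq_sum {Z Y : Type*} [Fintype Z] [Fintype Y] [DecidableEq Y]
    {P : Z × Y → ℝ} (hP : ∀ p, 0 ≤ P p) (F : Z → Y) :
    risk P F = ∑ z, margZ P z *
      ∑ y, |(if y = F z then (1 : ℝ) else 0) - P (z, y) / margZ P z| := by
  unfold risk
  refine Finset.sum_filter_of_ne fun z _ h => ?_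
  exact lt_of_le_of_ne (Finset.sum_nonneg fun y _ => hP _) fun h0 => h (by rw [← h0, zero_mul])

lemma le_margZ {Z Y : Type*} [Fintype Y] {P : Z × Y → ℝ} (hP : ∀ p, 0 ≤ P p) (z : Z) (y : Y) :
    P (z, y) ≤ margZ P z :=
  Finset.single_le_sum (f := fun y => P (z, y)) (fun _ _ => hP _) (Finset.mem_univ y)

lemma le_margY {Z Y : Type*} [Fintype Z] {P : Z × Y → ℝ} (hP : ∀ p, 0 ≤ P p) (z : Z) (y : Y) :
    P (z, y) ≤ margY P y :=
  Finset.single_le_sum (f := fun z => P (z, y)) (fun _ _ => hP _) (Finset.mem_univ z)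

lemma sum_margZ {Z Y : Type*} [Fintype Z] [Fintype Y] (P : Z × Y → ℝ) :
    ∑ z, margZ P z = ∑ p, P p :=
  (Fintype.sum_prod_type P).symm

/-- The risk is twice the probability of misclassification. -/
lemma risk_eq_two_mul {Z Y : Type*} [Fintype Z] [Fintype Y] [DecidableEq Y]
    {P : Z × Y → ℝ} (hP : ∀ p, 0 ≤ P p) (F : Z → Y) :
    risk P F = 2 * (∑ p, P p - ∑ z, P (z, F z)) := by
  rw [risk_eq_sum hP, ← sum_margZ, ← Finset.sum_sub_distrib, Finset.mul_sum]
  refine Finset.sum_congr rfl fun z _ => ?_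
  have hz0 : 0 ≤ margZ P z := Finset.sum_nonneg fun y _ => hP _
  have hrest : ∑ y ∈ Finset.univ.erase (F z), P (z, y) = margZ P z - P (z, F z) := by
    rw [Finset.sum_erase_eq_sub (Finset.mem_univ _)]; rfl
  have hterm : ∀ y, margZ P z * |(if y = F z then (1 : ℝ) else 0) - P (z, y) / margZ P z|
      = |(if y = F z then margZ P z else 0) - P (z, y)| := by
    intro y
    rcases hz0.eq_or_lt with h | h
    · have := le_margZ hP z y
      have h' : P (z, y) = 0 := le_antisymm (by linarith) (hP _)
      simp [← h, h']
    · rw [← abs_of_nonneg hz0, ← abs_mul, abs_of_nonneg hz0, mul_sub, mul_div_cancel₀ _ h.ne']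
      simp
  simp only [Finset.mul_sum, hterm]
  rw [← Finset.add_sum_erase _ _ (Finset.mem_univ (F z)), if_pos rfl, abs_of_nonneg (sub_nonneg.2 (le_margZ hP z _))]
  have : ∑ y ∈ Finset.univ.erase (F z), |(if y = F z then margZ P z else 0) - P (z, y)|
      = ∑ y ∈ Finset.univ.erase (F z), P (z, y) := by
    refine Finset.sum_congr rfl fun y hy => ?_
    rw [if_neg (Finset.ne_of_mem_erase hy), zero_sub, abs_neg, abs_of_nonneg (hP _)]
  rw [this, hrest]
  ring

lemma risk_le_risk_add_disag {Z Y : Type*} [Fintype Z] [Fintype Y] [DecidableEq Y]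
    {P : Z × Y → ℝ} (hP : ∀ p, 0 ≤ P p) (F G : Z → Y) :
    risk P F ≤ risk P G + disag Y (margZ P) F G := by
  rw [risk_eq_sum hP, risk_eq_sum hP, disag, ← Finset.sum_add_distrib]
  refine Finset.sum_le_sum fun z _ => ?_
  rw [← mul_add, ← Finset.sum_add_distrib]
  refine mul_le_mul_of_nonneg_left (Finset.sum_le_sum fun y _ => ?_)
    (Finset.sum_nonneg fun y _ => hP _)
  rw [add_comm]
  exact abs_sub_le _ _ _

lemma disag_le_risk_add_risk {Z Y : Type*} [Fintype Z] [Fintype Y] [DecidableEq Y]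
    {P : Z × Y → ℝ} (hP : ∀ p, 0 ≤ P p) (F G : Z → Y) :
    disag Y (margZ P) F G ≤ risk P F + risk P G := by
  rw [risk_eq_sum hP, risk_eq_sum hP, disag, ← Finset.sum_add_distrib]
  refine Finset.sum_le_sum fun z _ => ?_
  rw [← mul_add, ← Finset.sum_add_distrib]
  refine mul_le_mul_of_nonneg_left (Finset.sum_le_sum fun y _ => ?_)
    (Finset.sum_nonneg fun y _ => hP _)
  rw [abs_sub_comm (if y = G z then (1 : ℝ) else 0)]
  exact abs_sub_le _ _ _

lemma abs_disag_sub_disag_le {Z Y : Type*} [Fintype Z] [Fintype Y] [DecidableEq Y]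
    (P₁ P₂ : Z → ℝ) (F G : Z → Y) :
    |disag Y P₁ F G - disag Y P₂ F G| ≤ (1 / 2) * dHH Y P₁ P₂ := by
  rw [dHH, ← mul_assoc, one_div, inv_mul_cancel₀ two_ne_zero, one_mul]
  exact (le_ciSup (f := fun G => |disag Y P₁ F G - disag Y P₂ F G|)
      (Set.finite_range _).bddAbove G).trans
    (le_ciSup (f := fun F => ⨆ G, |disag Y P₁ F G - disag Y P₂ F G|)
      (Set.finite_range _).bddAbove F)

lemma pairDist_apply {Z Y : Type*} [Fintype Z] [Fintype Y] {Q : Z × Y → ℝ}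
    (hQ : ∀ p, 0 ≤ Q p) (p : Z × Z) :
    pairDist Q p = ∑ y, Q (p.1, y) * Q (p.2, y) / margY Q y := by
  unfold pairDist
  rw [Finset.sum_filter]
  refine Finset.sum_congr rfl fun y _ => ?_
  split_ifs with h
  · field_simp
  · have : margY Q y = 0 := le_antisymm (not_lt.1 h) (Finset.sum_nonneg fun z _ => hQ _)
    simp [this]

lemma sum_pair_left {Z Y : Type*} [Fintype Z] {Q : Z × Y → ℝ} (hQ : ∀ p, 0 ≤ Q p)
    (z : Z) (y : Y) : ∑ z', Q (z', y) * Q (z, y) / margY Q y = Q (z, y) := by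
  rw [← Finset.sum_div, ← Finset.sum_mul]
  change margY Q y * Q (z, y) / margY Q y = _
  rcases eq_or_ne (margY Q y) 0 with h | h
  · have := le_margY hQ z y
    rw [h, div_zero]
    exact le_antisymm (hQ _) (by linarith)
  · field_simp

lemma sum_pairDist_left {Z Y : Type*} [Fintype Z] [Fintype Y] {Q : Z × Y → ℝ}
    (hQ : ∀ p, 0 ≤ Q p) (z : Z) : ∑ z', pairDist Q (z', z) = margZ Q z := by
  simp only [pairDist_apply hQ]
  rw [Finset.sum_comm]
  exact Finset.sum_congr rfl fun y _ => sum_pair_left hQ z y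

lemma sum_pairDist_right {Z Y : Type*} [Fintype Z] [Fintype Y] {Q : Z × Y → ℝ}
    (hQ : ∀ p, 0 ≤ Q p) (z : Z) : ∑ z', pairDist Q (z, z') = margZ Q z := by
  rw [← sum_pairDist_left hQ]
  simp only [pairDist_apply hQ, mul_comm]

/-- Pointwise form of the data processing inequality for the chain `Z₁ → Y → Z₂`, combined with
`log x ≤ x - 1` for the posterior of the most likely label. -/
lemma pair_mul_log_le {q₁ q₂ b M a₁ a₂ m : ℝ} (h₁ : 0 ≤ q₁) (h₂ : 0 ≤ q₂) (hb : 0 ≤ b)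
    (hM : q₁ * q₂ / b ≤ M) (ha₁ : q₁ ≤ a₁) (ha₂ : q₂ ≤ a₂) (hm : q₂ ≤ m) :
    q₁ * q₂ / b * Real.log (M / (a₁ * a₂))
      ≤ q₁ * q₂ / b * (m / a₂ - 1) - q₁ * q₂ / b * Real.log b
        + (q₁ * M / a₁ - q₁ * q₂ / b) := by
  have hw : 0 ≤ q₁ * q₂ / b := by positivity
  rcases hw.eq_or_lt with h | h
  · rw [← h] at hM ⊢
    have : 0 ≤ q₁ * M / a₁ := div_nonneg (mul_nonneg h₁ hM) (h₁.trans ha₁)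
    simpa using this
  have hb' : 0 < b := hb.lt_of_ne (by rintro rfl; simp at h)
  have h₁' : 0 < q₁ := h₁.lt_of_ne (by rintro rfl; simp at h)
  have h₂' : 0 < q₂ := h₂.lt_of_ne (by rintro rfl; simp at h)
  have hM' : 0 < M := h.trans_le hM
  have ha₁' : 0 < a₁ := h₁'.trans_le ha₁
  have ha₂' : 0 < a₂ := h₂'.trans_le ha₂
  have hlog : Real.log (M / (a₁ * a₂))
      = Real.log (M * b / (a₁ * q₂)) + Real.log (q₂ / a₂) - Real.log b := by
    rw [← Real.log_mul (by positivity) (by positivity), ← Real.log_div (by positivity) hb'.ne']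
    congr 1
    field_simp
  have e₁ := Real.log_le_sub_one_of_pos (show 0 < M * b / (a₁ * q₂) by positivity)
  have e₂ := Real.log_le_sub_one_of_pos (show 0 < q₂ / a₂ by positivity)
  have e₃ : q₂ / a₂ ≤ m / a₂ := by gcongr
  have e₄ : q₁ * M / a₁ = q₁ * q₂ / b * (M * b / (a₁ * q₂)) := by field_simp
  rw [hlog, e₄]
  nlinarith [mul_le_mul_of_nonneg_left (add_le_add e₁ (e₂.trans (sub_le_sub_right e₃ 1))) hw]

/-- The error of the Bayes classifier is at most `H(Y) - I(Z₁; Z₂)`. -/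
lemma MI_pairDist_add_error_le_entY {Z Y : Type*} [Fintype Z] [Fintype Y]
    {Q : Z × Y → ℝ} (hQ : ∀ p, 0 ≤ Q p) {G : Z → Y} (hG : ∀ z y, Q (z, y) ≤ Q (z, G z)) :
    MI (pairDist Q) + (∑ p, Q p - ∑ z, Q (z, G z)) ≤ entY Q := by
  have hb : ∀ y, 0 ≤ margY Q y := fun y => Finset.sum_nonneg fun z _ => hQ _
  have hw : ∀ z z' y, 0 ≤ Q (z, y) * Q (z', y) / margY Q y := fun z z' y =>
    div_nonneg (mul_nonneg (hQ _) (hQ _)) (hb y)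
  have hMI : MI (pairDist Q) = ∑ z₁, ∑ z₂, ∑ y, Q (z₁, y) * Q (z₂, y) / margY Q y *
      Real.log (pairDist Q (z₁, z₂) / (margZ Q z₁ * margZ Q z₂)) := by
    simp only [MI, sum_pairDist_left hQ, sum_pairDist_right hQ]
    rw [Finset.sum_filter_of_ne, Fintype.sum_prod_type]
    · refine Finset.sum_congr rfl fun z₁ _ => Finset.sum_congr rfl fun z₂ _ => ?_
      rw [← Finset.sum_mul, ← pairDist_apply hQ (z₁, z₂)]
    · intro p _ h
      refine lt_of_le_of_ne ?_ fun h0 => h (by rw [← h0, zero_mul])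
      rw [pairDist_apply hQ]
      exact Finset.sum_nonneg fun y _ => hw _ _ _
  have hle : MI (pairDist Q) ≤ ∑ z₁, ∑ z₂, ∑ y,
      (Q (z₁, y) * Q (z₂, y) / margY Q y * (Q (z₂, G z₂) / margZ Q z₂ - 1)
        - Q (z₁, y) * Q (z₂, y) / margY Q y * Real.log (margY Q y)
        + (Q (z₁, y) * pairDist Q (z₁, z₂) / margZ Q z₁
          - Q (z₁, y) * Q (z₂, y) / margY Q y)) := by
    rw [hMI]
    refine Finset.sum_le_sum fun z₁ _ => Finset.sum_le_sum fun z₂ _ =>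
      Finset.sum_le_sum fun y _ => ?_
    refine pair_mul_log_le (hQ _) (hQ _) (hb y) ?_ (le_margZ hQ _ _) (le_margZ hQ _ _) (hG _ _)
    rw [pairDist_apply hQ]
    exact Finset.single_le_sum (f := fun y => Q (z₁, y) * Q (z₂, y) / margY Q y)
      (fun y _ => hw _ _ _) (Finset.mem_univ y)
  have hacc : ∑ z₁, ∑ z₂, ∑ y,
      Q (z₁, y) * Q (z₂, y) / margY Q y * (Q (z₂, G z₂) / margZ Q z₂ - 1)
        = ∑ z, Q (z, G z) - ∑ p, Q p := by
    rw [Finset.sum_comm, ← sum_margZ, ← Finset.sum_sub_distrib]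
    refine Finset.sum_congr rfl fun z _ => ?_
    simp only [← Finset.sum_mul]
    have := sum_pairDist_left hQ z
    simp only [pairDist_apply hQ] at this
    rw [this]
    rcases eq_or_ne (margZ Q z) 0 with h | h
    · have := le_margZ hQ z (G z)
      have := hQ (z, G z)
      rw [h, zero_mul]; linarith
    · field_simp
  have hent : ∑ z₁, ∑ z₂, ∑ y, Q (z₁, y) * Q (z₂, y) / margY Q y * Real.log (margY Q y)
      = ∑ y, margY Q y * Real.log (margY Q y) := by
    rw [Finset.sum_comm]
    have : ∀ z₂, ∑ z₁, ∑ y, Q (z₁, y) * Q (z₂, y) / margY Q y * Real.log (margY Q y)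
        = ∑ y, Q (z₂, y) * Real.log (margY Q y) := by
      intro z₂
      rw [Finset.sum_comm]
      refine Finset.sum_congr rfl fun y _ => ?_
      rw [← Finset.sum_mul, sum_pair_left hQ]
    simp only [this]
    rw [Finset.sum_comm]
    exact Finset.sum_congr rfl fun y _ => (Finset.sum_mul _ _ _).symm
  have hrem : ∑ z₁, ∑ z₂, ∑ y, (Q (z₁, y) * pairDist Q (z₁, z₂) / margZ Q z₁
      - Q (z₁, y) * Q (z₂, y) / margY Q y) = 0 := by
    refine Finset.sum_eq_zero fun z₁ _ => ?_
    simp only [Finset.sum_sub_distrib]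
    have := sum_pairDist_right hQ z₁
    simp only [← Finset.sum_div, ← Finset.sum_mul]
    rw [← Finset.mul_sum, this]
    simp only [pairDist_apply hQ] at this
    rw [this]
    change margZ Q z₁ * margZ Q z₁ / margZ Q z₁ - _ = 0
    rw [mul_self_div_self, sub_self]
  simp only [Finset.sum_add_distrib] at hle
  simp only [Finset.sum_sub_distrib] at hle hrem
  rw [hacc, hent, hrem] at hle
  unfold entY
  linarith

theorem target_risk_bound {Z Y : Type*} [Fintype Z] [Fintype Y] [Nonempty Z] [Nonempty Y]
    [DecidableEq Y]
    (PS PT : Z × Y → ℝ)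
    (hS0 : ∀ p, 0 ≤ PS p) (hS1 : ∑ p, PS p = 1)
    (hT0 : ∀ p, 0 ≤ PT p) (hT1 : ∑ p, PT p = 1)
    (F : Z → Y) :
    risk PT F ≤ risk PS F
      - 4 * MI (pairDist (fun p => (1 / 2) * (PS p + PT p)))
      + (1 / 2) * dHH Y (margZ PS) (margZ PT)
      + 4 * entY (fun p => (1 / 2) * (PS p + PT p)) := by
  have hQ : ∀ p, 0 ≤ (1 / 2) * (PS p + PT p) := fun p =>
    mul_nonneg (by norm_num) (add_nonneg (hS0 p) (hT0 p))
  choose G hG using fun z => Finite.exists_max fun y => (1 / 2) * (PS (z, y) + PT (z, y))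
  have hbayes := MI_pairDist_add_error_le_entY hQ hG
  simp only [← Finset.mul_sum, Finset.sum_add_distrib, hS1, hT1] at hbayes
  have hS := risk_eq_two_mul hS0 G
  have hT := risk_eq_two_mul hT0 G
  rw [hS1] at hS
  rw [hT1] at hT
  have hd := (abs_le.1 (abs_disag_sub_disag_le (margZ PS) (margZ PT) F G)).1
  have h₁ := risk_le_risk_add_disag hT0 F G
  have h₂ := disag_le_risk_add_risk hS0 F G
  linarith
end

section
/- Let P be a joint distribution on finite sets 𝒵₁ × 𝒵₂ with marginals P₁ and P₂. Then for every function f : 𝒵₁ × 𝒵₂ → ℝ: I(Z₁;Z₂) ≥ Σ_{z₁,z₂} P(z₁,z₂)·f(z₁,z₂) − e^{-1} · Σ_{z₁} Σ_{z₂} P₁(z₁)·P₂(z₂)·e^{f(z₁,z₂)}. -/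
open Finset

/-- Pointwise Fenchel–Young inequality behind the variational bound on relative entropy. -/
theorem mul_sub_exp_mul_le_mul_log_div {p q : ℝ} (hp : 0 < p) (hq : 0 < q) (x : ℝ) :
    p * x - Real.exp (-1) * (q * Real.exp x) ≤ p * Real.log (p / q) := by
  have h := Real.add_one_le_exp (x - 1 - Real.log (p / q))
  rw [Real.exp_sub, Real.exp_log (div_pos hp hq), sub_eq_add_neg x 1, Real.exp_add] at h
  have h' := mul_le_mul_of_nonneg_left h hp.le
  have e : p * (Real.exp x * Real.exp (-1) / (p / q)) = Real.exp (-1) * (q * Real.exp x) := by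
    field_simp
  rw [e] at h'
  linarith

theorem mi_variational_lower_bound {Z₁ Z₂ : Type*} [Fintype Z₁] [Fintype Z₂]
    [Nonempty Z₁] [Nonempty Z₂]
    (P : Z₁ × Z₂ → ℝ) (h0 : ∀ p, 0 ≤ P p) (h1 : ∑ p, P p = 1)
    (f : Z₁ × Z₂ → ℝ) :
    (∑ p, P p * f p)
      - Real.exp (-1) *
          ∑ z₁, ∑ z₂, margZ P z₁ * margY P z₂ * Real.exp (f (z₁, z₂))
      ≤ MI P := by
  rw [← Fintype.sum_prod_type' (fun z₁ z₂ => margZ P z₁ * margY P z₂ * Real.exp (f (z₁, z₂))),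
    Finset.mul_sum, ← Finset.sum_sub_distrib, MI, Finset.sum_filter]
  refine Finset.sum_le_sum fun p _ => ?_
  split_ifs with hp
  · have hZ : 0 < margZ P p.1 :=
      hp.trans_le (Finset.single_le_sum (f := fun b => P (p.1, b)) (fun _ _ => h0 _)
        (Finset.mem_univ p.2))
    have hY : 0 < margY P p.2 :=
      hp.trans_le (Finset.single_le_sum (f := fun a => P (a, p.2)) (fun _ _ => h0 _)
        (Finset.mem_univ p.1))
    exact mul_sub_exp_mul_le_mul_log_div hp (mul_pos hZ hY) (f p)
  · have hP : P p = 0 := le_antisymm (not_lt.mp hp) (h0 p)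
    have hZ : 0 ≤ margZ P p.1 := Finset.sum_nonneg fun _ _ => h0 _
    have hY : 0 ≤ margY P p.2 := Finset.sum_nonneg fun _ _ => h0 _
    rw [hP, zero_mul, zero_sub]
    exact neg_nonpos.mpr (by positivity)
end

section
/- Let P be a joint distribution on finite sets 𝒵₁ × 𝒵₂ with marginals P₁ and P₂, and assume P₁(z₁) > 0 for all z₁ and P₂(z₂) > 0 for all z₂. Then for every function f : 𝒵₁ × 𝒵₂ → ℝ: I(Z₁;Z₂) ≥ Σ_{z₁,z₂} P(z₁,z₂)·f(z₁,z₂) − log( Σ_{z₂} P₂(z₂) · Σ_{z₁} P₁(z₁)·e^{f(z₁,z₂)} ). -/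
open Finset

/-- Weighted form of `log x ≤ x - 1`, with the convention that a null atom contributes zero. -/
lemma mul_sub_log_add_le {p q t S : ℝ} (hp : 0 ≤ p) (hq : 0 < q) (hS : 0 < S) :
    p * t - p * Real.log S + p
      ≤ (if 0 < p then p * Real.log (p / q) else 0) + q * Real.exp t / S := by
  rcases hp.eq_or_lt with rfl | hp
  · simp only [zero_mul, lt_irrefl, if_false]
    have : 0 < q * Real.exp t / S := by positivity
    linarith
  · rw [if_pos hp]
    have hx : 0 < q * Real.exp t / (S * p) := by positivity
    have h := Real.log_le_sub_one_of_pos hx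
    rw [Real.log_div (by positivity) (by positivity), Real.log_mul hq.ne' (Real.exp_ne_zero t),
      Real.log_mul hS.ne' hp.ne', Real.log_exp] at h
    rw [Real.log_div hp.ne' hq.ne']
    have h2 := mul_le_mul_of_nonneg_left h hp.le
    have h3 : p * (q * Real.exp t / (S * p) - 1) = q * Real.exp t / S - p := by
      field_simp
    rw [h3] at h2
    linarith

theorem mi_dv_style_lower_bound {Z₁ Z₂ : Type*} [Fintype Z₁] [Fintype Z₂]
    [Nonempty Z₁] [Nonempty Z₂]
    (P : Z₁ × Z₂ → ℝ) (h0 : ∀ p, 0 ≤ P p) (h1 : ∑ p, P p = 1)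
    (hP1 : ∀ z₁, 0 < margZ P z₁) (hP2 : ∀ z₂, 0 < margY P z₂)
    (f : Z₁ × Z₂ → ℝ) :
    (∑ p, P p * f p)
      - Real.log (∑ z₂, margY P z₂ * ∑ z₁, margZ P z₁ * Real.exp (f (z₁, z₂)))
      ≤ MI P := by
  set S := ∑ z₂, margY P z₂ * ∑ z₁, margZ P z₁ * Real.exp (f (z₁, z₂)) with hSdef
  have hS : 0 < S := Finset.sum_pos (fun z₂ _ => mul_pos (hP2 z₂)
    (Finset.sum_pos (fun z₁ _ => mul_pos (hP1 z₁) (Real.exp_pos _)) Finset.univ_nonempty))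
    Finset.univ_nonempty
  have hsum : ∑ p : Z₁ × Z₂, margZ P p.1 * margY P p.2 * Real.exp (f p) = S := by
    rw [hSdef, Fintype.sum_prod_type_right]
    refine Finset.sum_congr rfl fun z₂ _ => ?_
    rw [Finset.mul_sum]
    exact Finset.sum_congr rfl fun z₁ _ => by ring
  have hMI : MI P = ∑ p : Z₁ × Z₂,
      if 0 < P p then P p * Real.log (P p / (margZ P p.1 * margY P p.2)) else 0 := by
    rw [← Finset.sum_filter]
    rfl
  have key := Finset.sum_le_sum fun (p : Z₁ × Z₂) (_ : p ∈ Finset.univ) =>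
    mul_sub_log_add_le (t := f p) (h0 p) (mul_pos (hP1 p.1) (hP2 p.2)) hS
  rw [Finset.sum_add_distrib, Finset.sum_add_distrib, Finset.sum_sub_distrib, ← Finset.sum_mul,
    ← Finset.sum_div, hsum, h1, div_self hS.ne', ← hMI] at key
  linarith
end

section
/- Let P_S and P_T be joint distributions on 𝒵 × 𝒴 and let P_{S+T} = (1/2)(P_S + P_T). Then for every classifier F' : 𝒵 → 𝒴: ε_{P_S}(F') + ε_{P_T}(F') = 4·Σ_{z : P_{S+T}(z)>0} P_{S+T}(z)·(1 − P_{S+T}(F'(z)|z)). -/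
open Finset

lemma margZ_half_add {Z Y : Type*} [Fintype Y] (P Q : Z × Y → ℝ) (z : Z) :
    margZ (fun p => (1 / 2) * (P p + Q p)) z = (1 / 2) * (margZ P z + margZ Q z) := by
  simp only [margZ, ← Finset.mul_sum, Finset.sum_add_distrib]

/-- The `ℓ¹` distance from a point mass to a probability vector. -/
lemma sum_abs_indicator_sub {Y : Type*} [Fintype Y] [DecidableEq Y] {q : Y → ℝ}
    (hq : ∀ y, 0 ≤ q y) (hq1 : ∑ y, q y = 1) (a : Y) :
    ∑ y, |(if y = a then (1 : ℝ) else 0) - q y| = 2 * (1 - q a) := by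
  have ha : q a ≤ 1 := hq1 ▸ Finset.single_le_sum (fun y _ => hq y) (Finset.mem_univ a)
  have h : ∀ y, |(if y = a then (1 : ℝ) else 0) - q y|
      = q y + if y = a then 1 - 2 * q a else 0 := by
    intro y
    split_ifs with hy
    · subst hy
      rw [abs_of_nonneg (by linarith)]
      ring
    · rw [zero_sub, abs_neg, abs_of_nonneg (hq y), add_zero]
  simp only [h, Finset.sum_add_distrib, hq1, Finset.sum_ite_eq', Finset.mem_univ, if_true]
  ring

/-- The expected misclassification probability, without conditional distributions. -/
lemma sum_margZ_mul_one_sub {Z Y : Type*} [Fintype Z] [Fintype Y] {P : Z × Y → ℝ}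
    (hP : ∀ p, 0 ≤ P p) (F : Z → Y) :
    ∑ z ∈ Finset.univ.filter (fun z => 0 < margZ P z),
        margZ P z * (1 - P (z, F z) / margZ P z)
      = ∑ z, (margZ P z - P (z, F z)) := by
  rw [Finset.sum_filter]
  refine Finset.sum_congr rfl fun z _ => ?_
  have hle := le_margZ hP z (F z)
  have h0 := hP (z, F z)
  split_ifs with h
  · field_simp
  · linarith

lemma risk_eq {Z Y : Type*} [Fintype Z] [Fintype Y] [DecidableEq Y] {P : Z × Y → ℝ}
    (hP : ∀ p, 0 ≤ P p) (F : Z → Y) :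
    risk P F = 2 * ∑ z, (margZ P z - P (z, F z)) := by
  rw [← sum_margZ_mul_one_sub hP, risk, Finset.mul_sum]
  refine Finset.sum_congr rfl fun z hz => ?_
  have hz : 0 < margZ P z := (Finset.mem_filter.mp hz).2
  rw [sum_abs_indicator_sub (q := fun y => P (z, y) / margZ P z)
    (fun y => div_nonneg (hP _) hz.le)
    (by rw [← Finset.sum_div]; exact div_self hz.ne')]
  ring

theorem sum_risks_mixture {Z Y : Type*} [Fintype Z] [Fintype Y] [Nonempty Z] [Nonempty Y]
    [DecidableEq Y]
    (PS PT : Z × Y → ℝ)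
    (hS0 : ∀ p, 0 ≤ PS p) (hS1 : ∑ p, PS p = 1)
    (hT0 : ∀ p, 0 ≤ PT p) (hT1 : ∑ p, PT p = 1)
    (F' : Z → Y) :
    risk PS F' + risk PT F'
      = 4 * ∑ z ∈ Finset.univ.filter
            (fun z => 0 < margZ (fun p => (1 / 2) * (PS p + PT p)) z),
          margZ (fun p => (1 / 2) * (PS p + PT p)) z *
            (1 - (1 / 2) * (PS (z, F' z) + PT (z, F' z)) /
              margZ (fun p => (1 / 2) * (PS p + PT p)) z) := by
  rw [risk_eq hS0, risk_eq hT0,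
    sum_margZ_mul_one_sub (P := fun p => (1 / 2) * (PS p + PT p))
      (fun p => mul_nonneg (by norm_num) (add_nonneg (hS0 p) (hT0 p))) F']
  simp only [margZ_half_add, Finset.mul_sum, ← Finset.sum_add_distrib]
  exact Finset.sum_congr rfl fun z _ => by ring
end

section
/- Let P be a joint distribution on 𝒵 × 𝒴 and let F* : 𝒵 → 𝒴 be any classifier satisfying F*(z) ∈ argmax_y P(y|z) for every z with P(z) > 0. Then I(Z;Y) ≤ H(Y) + Σ_{z : P(z)>0} P(z)·log P(F*(z)|z), where I(Z;Y) is the mutual information of the joint distribution P and H(Y) is the entropy of its 𝒴-marginal. -/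
open Finset

/-- Each summand of the mutual information is at most the value obtained by replacing the
conditional probability by an upper bound for it. -/
theorem mul_log_div_mul_le {p a b m : ℝ} (hp : 0 < p) (ha : 0 < a) (hb : 0 < b)
    (h : p / a ≤ m) : p * Real.log (p / (a * b)) ≤ p * Real.log m - p * Real.log b := by
  rw [← div_div, Real.log_div (div_pos hp ha).ne' hb.ne', mul_sub]
  gcongr

theorem mi_le_entropy_add_log_argmax {Z Y : Type*} [Fintype Z] [Fintype Y]
    [Nonempty Z] [Nonempty Y]
    (P : Z × Y → ℝ) (h0 : ∀ p, 0 ≤ P p) (h1 : ∑ p, P p = 1)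
    (Fs : Z → Y)
    (hargmax : ∀ z, 0 < margZ P z → ∀ y, P (z, y) / margZ P z ≤ P (z, Fs z) / margZ P z) :
    MI P ≤ entY P + ∑ z ∈ Finset.univ.filter (fun z => 0 < margZ P z),
        margZ P z * Real.log (P (z, Fs z) / margZ P z) := by
  have hZ (z : Z) (y : Y) : P (z, y) ≤ margZ P z :=
    Finset.single_le_sum (f := fun y => P (z, y)) (fun _ _ => h0 _) (Finset.mem_univ y)
  have hY (z : Z) (y : Y) : P (z, y) ≤ margY P y :=
    Finset.single_le_sum (f := fun z => P (z, y)) (fun _ _ => h0 _) (Finset.mem_univ z)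
  have hfilter : ∑ z ∈ Finset.univ.filter (fun z => 0 < margZ P z),
      margZ P z * Real.log (P (z, Fs z) / margZ P z) =
      ∑ z, margZ P z * Real.log (P (z, Fs z) / margZ P z) := by
    refine Finset.sum_filter_of_ne fun z _ hz => ?_
    exact (Finset.sum_nonneg fun y _ => h0 (z, y)).lt_of_ne' (left_ne_zero_of_mul hz)
  have hsum_margZ (g : Z → ℝ) : ∑ p, P p * g p.1 = ∑ z, margZ P z * g z := by
    simp only [Fintype.sum_prod_type, margZ, Finset.sum_mul]
  have hsum_margY (g : Y → ℝ) : ∑ p, P p * g p.2 = ∑ y, margY P y * g y := by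
    simp only [Fintype.sum_prod_type_right, margY, Finset.sum_mul]
  calc MI P ≤ ∑ p, (P p * Real.log (P (p.1, Fs p.1) / margZ P p.1) -
        P p * Real.log (margY P p.2)) := by
        rw [MI, Finset.sum_filter]
        refine Finset.sum_le_sum fun p _ => ?_
        split_ifs with hp
        · have hz : 0 < margZ P p.1 := hp.trans_le (hZ p.1 p.2)
          exact mul_log_div_mul_le hp hz (hp.trans_le (hY p.1 p.2)) (hargmax p.1 hz p.2)
        · simp [le_antisymm (not_lt.mp hp) (h0 p)]
    _ = _ := by
        rw [Finset.sum_sub_distrib, hsum_margZ fun z => Real.log (P (z, Fs z) / margZ P z),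
          hsum_margY fun y => Real.log (margY P y), hfilter, entY]
        ring
end

section
/- Let P_S and P_T be joint distributions on 𝒵 × 𝒴, let P_{S+T} = (1/2)(P_S + P_T), and let F* : 𝒵 → 𝒴 be any classifier satisfying F*(z) ∈ argmax_y P_{S+T}(y|z) for every z with P_{S+T}(z) > 0. Then ε_{P_S}(F*) + ε_{P_T}(F*) ≤ −4·I_{S+T}(Z;Y) + 4·H(Y), where I_{S+T}(Z;Y) is the mutual information of the joint distribution P_{S+T} and H(Y) is the entropy of the 𝒴-marginal of P_{S+T}. -/
open Finset

/-- The risk of a classifier is twice the probability of misclassification. -/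
theorem risk_eq_two_mul_sum {Z Y : Type*} [Fintype Z] [Fintype Y] [DecidableEq Y]
    (P : Z × Y → ℝ) (hP : ∀ p, 0 ≤ P p) (F : Z → Y) :
    risk P F = 2 * ∑ z, (margZ P z - P (z, F z)) := by
  have hle : ∀ z y, P (z, y) ≤ margZ P z := fun z y =>
    Finset.single_le_sum (f := fun y => P (z, y)) (fun y _ => hP (z, y)) (Finset.mem_univ y)
  unfold risk
  rw [Finset.sum_filter, Finset.mul_sum]
  refine Finset.sum_congr rfl fun z _ => ?_
  split_ifs with hz
  · have habs : ∀ y, margZ P z * |(if y = F z then (1 : ℝ) else 0) - P (z, y) / margZ P z|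
        = P (z, y) + if y = F z then margZ P z - 2 * P (z, F z) else 0 := by
      intro y
      have h0 : 0 ≤ P (z, y) / margZ P z := div_nonneg (hP _) hz.le
      have h1 : P (z, y) / margZ P z ≤ 1 := (div_le_one hz).2 (hle z y)
      split_ifs with hy
      · rw [abs_of_nonneg (by linarith), mul_sub, mul_div_cancel₀ _ hz.ne', hy]
        ring
      · rw [zero_sub, abs_neg, abs_of_nonneg h0, mul_div_cancel₀ _ hz.ne', add_zero]
    rw [Finset.mul_sum, Finset.sum_congr rfl fun y _ => habs y, Finset.sum_add_distrib,
      Finset.sum_ite_eq' Finset.univ (F z)]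
    simp only [Finset.mem_univ, if_true]
    change margZ P z + _ = _
    ring
  · have h1 := hle z (F z)
    have h2 := hP (z, F z)
    linarith

/-- The chain rule `H(Y) - I(Z;Y) = H(Y|Z)`. -/
theorem entY_sub_MI_eq {Z Y : Type*} [Fintype Z] [Fintype Y]
    (Q : Z × Y → ℝ) (hQ : ∀ p, 0 ≤ Q p) :
    entY Q - MI Q = ∑ z, ∑ y, -(Q (z, y) * Real.log (Q (z, y) / margZ Q z)) := by
  have hent : entY Q = ∑ z, ∑ y, -(Q (z, y) * Real.log (margY Q y)) := by
    unfold entY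
    rw [Finset.sum_comm, ← Finset.sum_neg_distrib]
    refine Finset.sum_congr rfl fun y _ => ?_
    rw [Finset.sum_neg_distrib, ← Finset.sum_mul]
    rfl
  unfold MI
  rw [hent, Finset.sum_filter, Fintype.sum_prod_type, ← Finset.sum_sub_distrib]
  refine Finset.sum_congr rfl fun z _ => ?_
  rw [← Finset.sum_sub_distrib]
  refine Finset.sum_congr rfl fun y _ => ?_
  split_ifs with h
  · have hz : 0 < margZ Q z := h.trans_le
      (Finset.single_le_sum (f := fun y => Q (z, y)) (fun y _ => hQ (z, y)) (Finset.mem_univ y))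
    have hy : 0 < margY Q y := h.trans_le
      (Finset.single_le_sum (f := fun z => Q (z, y)) (fun z _ => hQ (z, y)) (Finset.mem_univ z))
    change _ - Q (z, y) * Real.log (Q (z, y) / (margZ Q z * margY Q y)) = _
    rw [Real.log_div h.ne' (mul_pos hz hy).ne', Real.log_mul hz.ne' hy.ne',
      Real.log_div h.ne' hz.ne']
    ring
  · have h0 : Q (z, y) = 0 := le_antisymm (not_lt.1 h) (hQ _)
    simp [h0]

/-- The error probability of a maximum a posteriori classifier is at most `H(Y|Z)`. -/
theorem sum_margZ_sub_le_condEntropy {Z Y : Type*} [Fintype Z] [Fintype Y]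
    (Q : Z × Y → ℝ) (hQ : ∀ p, 0 ≤ Q p) (F : Z → Y)
    (hF : ∀ z, 0 < margZ Q z → ∀ y, Q (z, y) / margZ Q z ≤ Q (z, F z) / margZ Q z) :
    ∑ z, (margZ Q z - Q (z, F z))
      ≤ ∑ z, ∑ y, -(Q (z, y) * Real.log (Q (z, y) / margZ Q z)) := by
  refine Finset.sum_le_sum fun z _ => ?_
  have hm : 0 ≤ margZ Q z := Finset.sum_nonneg fun y _ => hQ (z, y)
  have hterm : ∀ y, Q (z, y) * (1 - Q (z, F z) / margZ Q z)
      ≤ -(Q (z, y) * Real.log (Q (z, y) / margZ Q z)) := by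
    intro y
    rcases (hQ (z, y)).eq_or_lt with h | h
    · simp [← h]
    · have hz : 0 < margZ Q z := h.trans_le
        (Finset.single_le_sum (f := fun y => Q (z, y)) (fun y _ => hQ (z, y))
          (Finset.mem_univ y))
      have hlog := Real.log_le_sub_one_of_pos (div_pos h hz)
      have hmax := hF z hz y
      rw [← mul_neg]
      exact mul_le_mul_of_nonneg_left (by linarith) h.le
  refine le_trans ?_ (Finset.sum_le_sum fun y _ => hterm y)
  rw [← Finset.sum_mul]
  change _ ≤ margZ Q z * _
  rcases hm.eq_or_lt with h | h
  · have := hQ (z, F z)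
    rw [← h]
    linarith
  · rw [mul_sub, mul_div_cancel₀ _ h.ne', mul_one]

theorem sum_risks_mi_bound {Z Y : Type*} [Fintype Z] [Fintype Y] [Nonempty Z] [Nonempty Y]
    [DecidableEq Y]
    (PS PT : Z × Y → ℝ)
    (hS0 : ∀ p, 0 ≤ PS p) (hS1 : ∑ p, PS p = 1)
    (hT0 : ∀ p, 0 ≤ PT p) (hT1 : ∑ p, PT p = 1)
    (Fs : Z → Y)
    (hargmax : ∀ z, 0 < margZ (fun p => (1 / 2) * (PS p + PT p)) z → ∀ y,
      (1 / 2) * (PS (z, y) + PT (z, y)) / margZ (fun p => (1 / 2) * (PS p + PT p)) z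
        ≤ (1 / 2) * (PS (z, Fs z) + PT (z, Fs z)) /
            margZ (fun p => (1 / 2) * (PS p + PT p)) z) :
    risk PS Fs + risk PT Fs
      ≤ -4 * MI (fun p => (1 / 2) * (PS p + PT p))
        + 4 * entY (fun p => (1 / 2) * (PS p + PT p)) := by
  set Q : Z × Y → ℝ := fun p => (1 / 2) * (PS p + PT p) with hQdef
  have hQ : ∀ p, 0 ≤ Q p := fun p => mul_nonneg (by norm_num) (add_nonneg (hS0 p) (hT0 p))
  have hrisk : risk PS Fs + risk PT Fs = 4 * ∑ z, (margZ Q z - Q (z, Fs z)) := by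
    rw [risk_eq_two_mul_sum PS hS0, risk_eq_two_mul_sum PT hT0, ← mul_add,
      ← Finset.sum_add_distrib, Finset.mul_sum, Finset.mul_sum]
    refine Finset.sum_congr rfl fun z _ => ?_
    simp only [margZ, hQdef, ← Finset.mul_sum, Finset.sum_add_distrib]
    ring
  have hbound := sum_margZ_sub_le_condEntropy Q hQ Fs hargmax
  rw [← entY_sub_MI_eq Q hQ] at hbound
  linarith
end

section
/- Let P_T and Q be joint distributions on 𝒵 × 𝒴, and assume Q(z) > 0 for every z with P_T(z) > 0. For a classifier F' : 𝒵 → 𝒴 and a distribution P on 𝒵 × 𝒴, write ε_P(F', Q(Y|Z)) = Σ_{z : P(z)>0} P(z) · Σ_y |1[y = F'(z)] − Q(y|z)| for the disagreement between F' and the surrogate conditional label distribution. Then ε_{P_T}(F', Q(Y|Z)) ≤ ε_Q(F') + d₁(P_T(Z), Q(Z)), where ε_Q(F') is the expected risk of F' under Q and d₁(P_T(Z), Q(Z)) = Σ_z |P_T(z) − Q(z)| is the L₁-distance between the 𝒵-marginals. -/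
open Finset

lemma margZ_nonneg {Z Y : Type*} [Fintype Y] {P : Z × Y → ℝ} (hP : ∀ p, 0 ≤ P p) (z : Z) :
    0 ≤ margZ P z :=
  Finset.sum_nonneg fun y _ => hP (z, y)

/-- The `L₁`-distance from a point mass to a sub-probability vector is at most `2`. -/
lemma sum_abs_indicator_sub_le_two {Y : Type*} [Fintype Y] [DecidableEq Y] {q : Y → ℝ}
    (hq0 : ∀ y, 0 ≤ q y) (hq1 : ∑ y, q y ≤ 1) (a : Y) :
    ∑ y, |(if y = a then (1 : ℝ) else 0) - q y| ≤ 2 := by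
  calc ∑ y, |(if y = a then (1 : ℝ) else 0) - q y|
      ≤ ∑ y, ((if y = a then (1 : ℝ) else 0) + q y) := by
        refine Finset.sum_le_sum fun y _ => ?_
        have := hq0 y
        rw [abs_le]
        split_ifs <;> constructor <;> linarith
    _ ≤ 2 := by
        rw [Finset.sum_add_distrib, Finset.sum_ite_eq' Finset.univ a]
        simp only [Finset.mem_univ, if_true]
        linarith

/-- A nonnegative weighted sum may be restricted to the support of the weight. -/
lemma sum_filter_pos_mul {Z : Type*} [Fintype Z] {w : Z → ℝ} (hw : ∀ z, 0 ≤ w z) (g : Z → ℝ) :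
    ∑ z ∈ Finset.univ.filter (fun z => 0 < w z), w z * g z = ∑ z, w z * g z := by
  refine Finset.sum_filter_of_ne fun z _ hz => (hw z).lt_of_ne' ?_
  exact left_ne_zero_of_mul hz

/-- Changing the weights of an average of a `[0, 2]`-valued function costs at most their
`L₁`-distance. -/
lemma sum_mul_le_sum_mul_add_sum_abs_sub {Z : Type*} [Fintype Z] {p q g : Z → ℝ}
    (hpq : ∑ z, p z = ∑ z, q z) (hg0 : ∀ z, 0 ≤ g z) (hg2 : ∀ z, g z ≤ 2) :
    ∑ z, p z * g z ≤ ∑ z, q z * g z + ∑ z, |p z - q z| := by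
  have key : ∑ z, (p z - q z) * (g z - 1) ≤ ∑ z, |p z - q z| := by
    refine Finset.sum_le_sum fun z _ => (le_abs_self _).trans ?_
    rw [abs_mul]
    refine mul_le_of_le_one_right (abs_nonneg _) (abs_le.2 ⟨?_, ?_⟩)
    · linarith [hg0 z]
    · linarith [hg2 z]
  have expand : ∑ z, (p z - q z) * (g z - 1) =
      ∑ z, p z * g z - ∑ z, q z * g z - (∑ z, p z - ∑ z, q z) := by
    simp only [← Finset.sum_sub_distrib]
    exact Finset.sum_congr rfl fun z _ => by ring
  linarith

theorem surrogate_disagreement_bound {Z Y : Type*} [Fintype Z] [Fintype Y]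
    [Nonempty Z] [Nonempty Y] [DecidableEq Y]
    (PT Q : Z × Y → ℝ)
    (hT0 : ∀ p, 0 ≤ PT p) (hT1 : ∑ p, PT p = 1)
    (hQ0 : ∀ p, 0 ≤ Q p) (hQ1 : ∑ p, Q p = 1)
    (hQpos : ∀ z, 0 < margZ PT z → 0 < margZ Q z)
    (F' : Z → Y) :
    (∑ z ∈ Finset.univ.filter (fun z => 0 < margZ PT z),
        margZ PT z * ∑ y, |(if y = F' z then (1 : ℝ) else 0) - Q (z, y) / margZ Q z|)
      ≤ risk Q F' + ∑ z, |margZ PT z - margZ Q z| := by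
  rw [risk, sum_filter_pos_mul (margZ_nonneg hT0), sum_filter_pos_mul (margZ_nonneg hQ0)]
  refine sum_mul_le_sum_mul_add_sum_abs_sub ?_
    (fun z => Finset.sum_nonneg fun y _ => abs_nonneg _) fun z => ?_
  · rw [sum_margZ, sum_margZ, hT1, hQ1]
  · refine sum_abs_indicator_sub_le_two
      (fun y => div_nonneg (hQ0 _) (margZ_nonneg hQ0 z)) ?_ (F' z)
    rw [← Finset.sum_div]
    exact div_self_le_one _
end
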